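/- Let f : ℝ⁶ → ℝ be given by f(x) = x₂. There is no Darboux chart for ω^f near 0: there do not exist an open set U ⊆ ℝ⁶ containing 0, a map φ : U → ℝ⁶ that is a C¹-diffeomorphism onto an open subset of ℝ⁶, and a single (constant) 3-form β ∈ Λ³(ℝ⁶)* such that for all p ∈ U one has ω^f_p = (D_pφ)*β, where D_pφ is the derivative of φ at p. -/

import Mathlib

/-- `dx3 i j k` is the alternating 3-form `dxⁱ ∧ dxʲ ∧ dxᵏ` on `ℝ⁶ = Fin 6 → ℝ`. -/
noncomputable def dx3 (i j k : Fin 6) : AlternatingMap ℝ (Fin 6 → ℝ) ℝ (Fin 3) :=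
  (Matrix.detRowAlternating : AlternatingMap ℝ (Fin 3 → ℝ) ℝ (Fin 3)).compLinearMap
    (LinearMap.funLeft ℝ ℝ ![i, j, k])

/-- For `f : ℝ⁶ → ℝ`, the field of 3-forms
`ω^f_p = dx^{135} − dx^{146} − dx^{236} + f(p)·dx^{245}` on `ℝ⁶`. -/
noncomputable def omegaF (f : (Fin 6 → ℝ) → ℝ) (p : Fin 6 → ℝ) :
    AlternatingMap ℝ (Fin 6 → ℝ) ℝ (Fin 3) :=
  dx3 0 2 4 - dx3 0 3 5 - dx3 1 2 5 + f p • dx3 1 3 4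

/-- The contraction of the 3-form `η` with `v` satisfies the Plücker relations, i.e. it is a
decomposable 2-form. -/
def ContractionDecomposable {V : Type*} [AddCommGroup V] [Module ℝ V]
    (η : AlternatingMap ℝ V ℝ (Fin 3)) (v : V) : Prop :=
  ∀ a b c d : V, η ![v, a, b] * η ![v, c, d] - η ![v, a, c] * η ![v, b, d]
    + η ![v, a, d] * η ![v, b, c] = 0

theorem compLinearMap_apply_vec_three {V W : Type*} [AddCommGroup V] [Module ℝ V]
    [AddCommGroup W] [Module ℝ W] (η : AlternatingMap ℝ W ℝ (Fin 3)) (L : V →ₗ[ℝ] W)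
    (a b c : V) : η.compLinearMap L ![a, b, c] = η ![L a, L b, L c] := by
  rw [AlternatingMap.compLinearMap_apply]
  congr 1
  ext i
  fin_cases i <;> rfl

theorem contractionDecomposable_compLinearMap_iff {V W : Type*} [AddCommGroup V] [Module ℝ V]
    [AddCommGroup W] [Module ℝ W] (η : AlternatingMap ℝ W ℝ (Fin 3)) {L : V →ₗ[ℝ] W}
    (hL : Function.Surjective L) (v : V) :
    ContractionDecomposable (η.compLinearMap L) v ↔ ContractionDecomposable η (L v) := by
  simp only [ContractionDecomposable, compLinearMap_apply_vec_three, hL.forall]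

theorem dx3_apply (i j k : Fin 6) (a b c : Fin 6 → ℝ) :
    dx3 i j k ![a, b, c] = Matrix.det !![a i, a j, a k; b i, b j, b k; c i, c j, c k] := by
  rw [dx3, compLinearMap_apply_vec_three]
  change Matrix.det _ = _
  congr 1
  ext m n
  fin_cases m <;> fin_cases n <;> rfl

theorem omegaF_apply (f : (Fin 6 → ℝ) → ℝ) (p a b c : Fin 6 → ℝ) :
    omegaF f p ![a, b, c] =
      dx3 0 2 4 ![a, b, c] - dx3 0 3 5 ![a, b, c] - dx3 1 2 5 ![a, b, c]
        + f p * dx3 1 3 4 ![a, b, c] :=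
  rfl

theorem contractionDecomposable_omegaF_of_eq_zero {f : (Fin 6 → ℝ) → ℝ} {p : Fin 6 → ℝ}
    (hp : f p = 0) : ContractionDecomposable (omegaF f p) (Pi.single 4 1) := by
  intro a b c d
  simp [omegaF_apply, dx3_apply, Matrix.det_fin_three, hp]
  ring

theorem eq_zero_of_contractionDecomposable_omegaF {f : (Fin 6 → ℝ) → ℝ} {p v : Fin 6 → ℝ}
    (hp : f p < 0) (hv : ContractionDecomposable (omegaF f p) v) : v = 0 := by
  have h₁ := hv (Pi.single 2 1) (Pi.single 3 1) (Pi.single 4 1) (Pi.single 5 1)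
  have h₂ := hv (Pi.single 0 1) (Pi.single 1 1) (Pi.single 4 1) (Pi.single 5 1)
  have h₃ := hv (Pi.single 0 1) (Pi.single 1 1) (Pi.single 2 1) (Pi.single 3 1)
  simp [omegaF_apply, dx3_apply, Matrix.det_fin_three] at h₁ h₂ h₃
  have key : ∀ x y : ℝ, x ^ 2 - f p * y ^ 2 = 0 → x = 0 ∧ y = 0 := by
    intro x y h
    have hy : y = 0 := by
      by_contra hy
      nlinarith [sq_nonneg x, mul_pos (neg_pos.2 hp) (sq_pos_of_ne_zero hy)]
    subst hy
    simpa using h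
  obtain ⟨h0, h1⟩ := key (v 0) (v 1) (by linarith)
  obtain ⟨h2, h3⟩ := key (v 2) (v 3) (by linarith)
  obtain ⟨h5, h4⟩ := key (v 5) (v 4) (by linarith)
  ext i
  fin_cases i <;> assumption

theorem bijective_fderiv_of_leftInverse {E : Type*} [NormedAddCommGroup E] [NormedSpace ℝ E]
    [FiniteDimensional ℝ E] {φ ψ : E → E} {x : E} (hφ : DifferentiableAt ℝ φ x)
    (hψ : DifferentiableAt ℝ ψ (φ x)) (h : ∀ᶠ y in nhds x, ψ (φ y) = y) :
    Function.Bijective (fderiv ℝ φ x).toLinearMap := by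
  have hcomp : (fderiv ℝ ψ (φ x)).comp (fderiv ℝ φ x) = ContinuousLinearMap.id ℝ E :=
    (hψ.hasFDerivAt.comp x hφ.hasFDerivAt).unique
      ((hasFDerivAt_id x).congr_of_eventuallyEq h)
  have hinj : Function.Injective (fderiv ℝ φ x).toLinearMap :=
    Function.LeftInverse.injective (g := fderiv ℝ ψ (φ x)) fun v => DFunLike.congr_fun hcomp v
  exact ⟨hinj, LinearMap.injective_iff_surjective.1 hinj⟩

/-- For `f(x) = x₂` there is no Darboux chart for `ω^f` near `0`: no
C¹-diffeomorphism `φ` of a neighbourhood `U` of `0` onto an open set pulls a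
single constant 3-form `β` back to `ω^f` on `U`. -/
theorem no_darboux_chart :
    ¬ ∃ (U : Set (Fin 6 → ℝ)) (φ ψ : (Fin 6 → ℝ) → (Fin 6 → ℝ))
        (β : AlternatingMap ℝ (Fin 6 → ℝ) ℝ (Fin 3)),
      (0 : Fin 6 → ℝ) ∈ U ∧ IsOpen U ∧
      Set.InjOn φ U ∧ IsOpen (φ '' U) ∧
      ContDiffOn ℝ 1 φ U ∧
      (∀ x ∈ U, ψ (φ x) = x) ∧ ContDiffOn ℝ 1 ψ (φ '' U) ∧
      (∀ p ∈ U,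
        omegaF (fun x => x 1) p = β.compLinearMap (fderiv ℝ φ p).toLinearMap) := by
  rintro ⟨U, φ, ψ, β, h0, hU, -, hV, hφ, hψφ, hψ, hω⟩
  have hbij : ∀ p ∈ U, Function.Bijective (fderiv ℝ φ p).toLinearMap := fun p hp =>
    bijective_fderiv_of_leftInverse
      ((hφ.contDiffAt (hU.mem_nhds hp)).differentiableAt one_ne_zero)
      ((hψ.contDiffAt (hV.mem_nhds ⟨p, hp, rfl⟩)).differentiableAt one_ne_zero)
      (Filter.eventually_of_mem (hU.mem_nhds hp) hψφ)
  obtain ⟨p, hp, hp1⟩ : ∃ p ∈ U, p 1 < 0 := by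
    obtain ⟨ε, hε, hball⟩ := Metric.isOpen_iff.1 hU 0 h0
    refine ⟨Pi.single 1 (-(ε / 2)), hball ?_, by simpa using hε⟩
    rw [mem_ball_zero_iff, Pi.norm_single, norm_neg, Real.norm_of_nonneg (by positivity)]
    linarith
  have hβ : ContractionDecomposable β ((fderiv ℝ φ 0).toLinearMap (Pi.single 4 1)) := by
    rw [← contractionDecomposable_compLinearMap_iff β (hbij 0 h0).2, ← hω 0 h0]
    exact contractionDecomposable_omegaF_of_eq_zero rfl
  obtain ⟨v, hv⟩ := (hbij p hp).2 ((fderiv ℝ φ 0).toLinearMap (Pi.single 4 1))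
  rw [← hv, ← contractionDecomposable_compLinearMap_iff β (hbij p hp).2, ← hω p hp] at hβ
  rw [eq_zero_of_contractionDecomposable_omegaF hp1 hβ, map_zero] at hv
  have := (map_eq_zero_iff _ (hbij 0 h0).1).1 hv.symm
  simp at this
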